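/- arXiv:2407.08293 — 3 statements merged into one kernel-verified Lean document; each statement's English description precedes it below -/
import Mathlib

section
/- With notation as in the jumping-polynomial construction: suppose k ∈ ℕ, i ∈ ℕ₀ and (A,C) ∈ ℕ₀^k × ℕ₀^i (supported on indices where the P- and T-sequences are defined). Let σ = |(A,C)| and m = max(k, m_i). Then there exist (B,D) ∈ ℕ₀^m × ℕ₀^i, θ ∈ 𝐤 and f ∈ 𝒜⁺_σ such that |(B,D)| = σ, (B,D) is irreducible with respect to 𝒯, and P^AT^C = θP^BT^D + f in R. -/
/-! Core combinatorial definitions for the jumping-polynomial construction. -/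

namespace Jump

/-- Tuples of nonnegative integers, indexed by positive integers (index 0 unused). -/
abbrev Vec := ℕ → ℕ

/-- Pairs of tuples. -/
abbrev PVec := Vec × Vec

/-- `A` is a tuple in `ℕ₀^k` (entries indexed by `1, …, k`). -/
def Supp (k : ℕ) (A : Vec) : Prop := ∀ j : ℕ, (j = 0 ∨ k < j) → A j = 0

/-- `A` is a tuple in `ℤ^k` (entries indexed by `1, …, k`). -/
def SuppZ (k : ℕ) (A : ℕ → ℤ) : Prop := ∀ j : ℕ, (j = 0 ∨ k < j) → A j = 0

/-- `(A, C)` is irreducible with respect to a set `T` of pairs of tuples: no member of `T`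
is componentwise less than or equal to `(A, C)`. -/
def Irr (T : Set PVec) (p : PVec) : Prop := ∀ bd ∈ T, ¬ (bd.1 ≤ p.1 ∧ bd.2 ≤ p.2)

/-- The weight `A·β(k) = a₁β₁ + ⋯ + a_kβ_k` of a tuple of nonnegative integers. -/
noncomputable def wtA (β : ℕ → ℝ) (k : ℕ) (A : Vec) : ℝ :=
  ∑ j ∈ Finset.Icc 1 k, (A j : ℝ) * β j

/-- The weight of a tuple of integers. -/
noncomputable def wtZ (β : ℕ → ℝ) (k : ℕ) (A : ℕ → ℤ) : ℝ :=
  ∑ j ∈ Finset.Icc 1 k, (A j : ℝ) * β j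

/-- The weight `|(A, C)| = A·β(k) + C·γ(i)` of a pair of tuples. -/
noncomputable def wt (β γ : ℕ → ℝ) (k i : ℕ) (p : PVec) : ℝ :=
  wtA β k p.1 + wtA γ i p.2

/-- The group `G_n = β₁ℤ + ⋯ + β_nℤ` (as a subset of `ℝ`; `G_0 = {0}`). -/
noncomputable def Gr (β : ℕ → ℝ) (n : ℕ) : Set ℝ :=
  {t | ∃ A : ℕ → ℤ, SuppZ n A ∧ t = wtZ β n A}

/-- The semigroup `S_n = β₁ℕ₀ + ⋯ + β_nℕ₀` (as a subset of `ℝ`; `S_0 = {0}`). -/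
noncomputable def Sg (β : ℕ → ℝ) (n : ℕ) : Set ℝ :=
  {t | ∃ A : Vec, Supp n A ∧ t = wtA β n A}

/-- The set `G_k + H_i`. -/
noncomputable def GrH (β γ : ℕ → ℝ) (k i : ℕ) : Set ℝ :=
  {t | ∃ a ∈ Gr β k, ∃ b ∈ Gr γ i, t = a + b}

/-- The set `G + H_i`, where `G = ⋃_{n ≤ len} G_n`. -/
noncomputable def GH (β γ : ℕ → ℝ) (len : ℕ∞) (i : ℕ) : Set ℝ :=
  {t | ∃ k : ℕ, (k : ℕ∞) ≤ len ∧ t ∈ GrH β γ k i}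

/-- The set `S_k + U_i`. -/
noncomputable def SU (β γ : ℕ → ℝ) (k i : ℕ) : Set ℝ :=
  {t | ∃ a ∈ Sg β k, ∃ b ∈ Sg γ i, t = a + b}

/-- The `j`-th standard basis vector `E_j`. -/
def unitVec (j : ℕ) : Vec := fun l => if l = j then 1 else 0

/-- The set `𝒫 = {(q_jE_j, 0̄) : j ≥ 2, q_j < ∞}`. -/
def Pset (q : ℕ → ℕ∞) : Set PVec :=
  {p | ∃ j : ℕ, 2 ≤ j ∧ ∃ t : ℕ, q j = (t : ℕ∞) ∧
        p = (fun l => t * unitVec j l, fun _ => 0)}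

/-- `(A, C) ∈ ℕ₀^{m_i} × ℕ₀^i` pushes `γ_i`: `c_i > 0` and `|(A, C)| ∈ S_{m_i} + U_{i-1}`. -/
noncomputable def Push (β γ : ℕ → ℝ) (mi i : ℕ) (p : PVec) : Prop :=
  0 < p.2 i ∧ wt β γ mi i p ∈ SU β γ mi (i - 1)

/-- `(A, C)` is reduced: it pushes `γ_i` and no pair strictly below it (componentwise) does. -/
noncomputable def Red (β γ : ℕ → ℝ) (mi i : ℕ) (p : PVec) : Prop :=
  Push β γ mi i p ∧
    ∀ p' : PVec, p'.1 ≤ p.1 → p'.2 ≤ p.2 → p' ≠ p → ¬ Push β γ mi i p'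

/-- The set `𝒟_i`, built from `𝒯_i`: empty if `s_i = ∞`, otherwise the pairs in
`ℕ₀^{m_i} × ℕ₀^i` that are irreducible with respect to `𝒯_i` and reduced. -/
noncomputable def Dstep (β γ : ℕ → ℝ) (s : ℕ → ℕ∞) (m : ℕ → ℕ) (i : ℕ)
    (Ti : Set PVec) : Set PVec :=
  if s i = ⊤ then ∅ else
    {p | Supp (m i) p.1 ∧ Supp i p.2 ∧ Irr Ti p ∧ Red β γ (m i) i p}

/-- The chain `𝒯_1 = 𝒫`, `𝒯_{i+1} = 𝒯_i ∪ 𝒟_i` (here `Tchain 0 = Tchain 1 = 𝒫`,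
which is forced by the convention `s 0 = ⊤`). -/
noncomputable def Tchain (β γ : ℕ → ℝ) (q s : ℕ → ℕ∞) (m : ℕ → ℕ) : ℕ → Set PVec
  | 0 => Pset q
  | n + 1 => Tchain β γ q s m n ∪ Dstep β γ s m n (Tchain β γ q s m n)

/-- The set `𝒯 = ⋃_i 𝒯_i`. -/
noncomputable def Tfull (β γ : ℕ → ℝ) (q s : ℕ → ℕ∞) (m : ℕ → ℕ) : Set PVec :=
  ⋃ n, Tchain β γ q s m n

/-- A tuple `A ∈ ℤ^k` is permissible: `0 ≤ a_j < q_j` for all `1 ≤ j ≤ k` with `q_j < ∞`. -/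
def PermZ (q : ℕ → ℕ∞) (k : ℕ) (A : ℕ → ℤ) : Prop :=
  ∀ j : ℕ, 1 ≤ j → j ≤ k → ∀ t : ℕ, q j = (t : ℕ∞) → 0 ≤ A j ∧ A j < (t : ℤ)

/-- A tuple `A ∈ ℕ₀^k` is permissible: `a_j < q_j` for all `1 ≤ j ≤ k` with `q_j < ∞`. -/
def PermN (q : ℕ → ℕ∞) (k : ℕ) (A : Vec) : Prop :=
  ∀ j : ℕ, 1 ≤ j → j ≤ k → ∀ t : ℕ, q j = (t : ℕ∞) → A j < t

/-- The abstract combinatorial setup of the jumping-polynomial construction: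
a finite (of length `len`) or infinite (`len = ⊤`) sequence `β` of positive reals,
a sequence `γ` of nonnegative reals, and the derived data `q_j`, `s_i`, `m_i`
defined by their minimality properties. -/
structure Setup where
  /-- the length of the `β`-sequence (possibly `∞`) -/
  len : ℕ∞
  β : ℕ → ℝ
  γ : ℕ → ℝ
  q : ℕ → ℕ∞
  s : ℕ → ℕ∞
  m : ℕ → ℕ
  hlen : 2 ≤ len
  hβ : ∀ j : ℕ, 1 ≤ j → (j : ℕ∞) ≤ len → 0 < β j
  hγ : ∀ i : ℕ, 1 ≤ i → 0 ≤ γ i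
  hq1 : q 1 = ⊤
  hqtop : ∀ j : ℕ, len < (j : ℕ∞) → q j = ⊤
  hq : ∀ j : ℕ, 2 ≤ j → (j : ℕ∞) ≤ len →
    q j = sInf {x : ℕ∞ | ∃ t : ℕ, x = (t : ℕ∞) ∧ 0 < t ∧ (t : ℝ) * β j ∈ Gr β (j - 1)}
  /-- if `q_j = ∞` then `β_j` is the last term of the `β`-sequence, and conversely -/
  hlast : ∀ j : ℕ, 2 ≤ j → (j : ℕ∞) ≤ len → (q j = ⊤ ↔ len = (j : ℕ∞))
  /-- `β_{j+1} > q_jβ_j` whenever `q_j < ∞` -/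
  hgrow : ∀ j : ℕ, 2 ≤ j → (j : ℕ∞) ≤ len → ∀ t : ℕ, q j = (t : ℕ∞) →
    (t : ℝ) * β j < β (j + 1)
  hs0 : s 0 = ⊤
  hs : ∀ i : ℕ, 1 ≤ i →
    s i = sInf {x : ℕ∞ | ∃ t : ℕ, x = (t : ℕ∞) ∧ 0 < t ∧ (t : ℝ) * γ i ∈ GH β γ len (i - 1)}
  hm0 : m 0 = 1
  hmtop : ∀ i : ℕ, 1 ≤ i → s i = ⊤ → m i = m (i - 1)
  hmfin : ∀ i : ℕ, 1 ≤ i → ∀ t : ℕ, s i = (t : ℕ∞) →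
    m i = max (m (i - 1))
      (sInf {j : ℕ | 1 ≤ j ∧ (j : ℕ∞) ≤ len ∧ (t : ℝ) * γ i ∈ GrH β γ j (i - 1)})
  hmlen : ∀ i : ℕ, 1 ≤ m i ∧ ((m i : ℕ) : ℕ∞) ≤ len

end Jump

namespace Jump

open Classical in
/-- The added set at step `i` of the `𝒯`-chain in the full construction: `{(0̄, E_i)}` if
`T_i = 0`, and `𝒟_i` otherwise. -/
noncomputable def Astep (β γ : ℕ → ℝ) (s : ℕ → ℕ∞) (m : ℕ → ℕ) (Tz : ℕ → Prop)
    (i : ℕ) (Ti : Set PVec) : Set PVec :=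
  if i = 0 then ∅
  else if Tz i then {(fun _ => 0, unitVec i)}
  else Dstep β γ s m i Ti

open Classical in
/-- The set `𝒟_i` in the full construction: empty when `T_i = 0`. -/
noncomputable def DsetR (β γ : ℕ → ℝ) (s : ℕ → ℕ∞) (m : ℕ → ℕ) (Tz : ℕ → Prop)
    (i : ℕ) (Ti : Set PVec) : Set PVec :=
  if Tz i then ∅ else Dstep β γ s m i Ti

/-- The chain `𝒯_1 = 𝒫`, `𝒯_{i+1} = 𝒯_i ∪ 𝒟_i` (resp. `𝒯_{i+1} = 𝒯_i ∪ {(0̄, E_i)}` when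
`T_i = 0`) of the full construction. -/
noncomputable def TchainR (β γ : ℕ → ℝ) (q s : ℕ → ℕ∞) (m : ℕ → ℕ) (Tz : ℕ → Prop) :
    ℕ → Set PVec
  | 0 => Pset q
  | n + 1 => TchainR β γ q s m Tz n ∪ Astep β γ s m Tz n (TchainR β γ q s m Tz n)

/-- The set `𝒯 = ⋃_i 𝒯_i` of the full construction. -/
noncomputable def TfullR (β γ : ℕ → ℝ) (q s : ℕ → ℕ∞) (m : ℕ → ℕ) (Tz : ℕ → Prop) :
    Set PVec :=
  ⋃ n, TchainR β γ q s m Tz n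

/-- The full setting of the paper: `𝐤` a field, `K` an algebraic function field of
transcendence degree 3 over `𝐤`, `ν` a rank 1 `𝐤`-valuation of `K` (with real values,
written additively) with residue field `𝐤`, and `(R, m_R)` a 3-dimensional regular local
subring of `K` with quotient field `K`, dominated by `ν`, with regular parameters
`x, y, z` of increasing value; together with the sequences `{P_j}`, `{T_i}` of jumping
polynomials produced by the algorithm of Section 3, and all their associated data
(`β`, `γ`, `q`, `s`, `m`, `δ`, `𝒫`, `𝒟_i`, `𝒯_i`). -/
structure RSetup (K : Type) [Field K] where
  /-- the coefficient field `𝐤`, as a subfield of `K` -/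
  kk : Subfield K
  /-- the valuation, written additively -/
  ν : K → ℝ
  /-- the regular local ring `R` -/
  R : Subring K
  x : K
  y : K
  z : K
  /-- the length of the sequence `{P_j}` (possibly `∞`) -/
  len : ℕ∞
  P : ℕ → K
  T : ℕ → K
  β : ℕ → ℝ
  γ : ℕ → ℝ
  q : ℕ → ℕ∞
  s : ℕ → ℕ∞
  m : ℕ → ℕ
  δ : ℕ → ℕ
  -- `K` is an algebraic function field of transcendence degree 3 over `𝐤`:
  hfg : ∃ t : Finset K, Subfield.closure ((kk : Set K) ∪ (t : Set K)) = ⊤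
  htrdeg : ∃ sfn : Fin 3 → K,
    Function.Injective (MvPolynomial.eval₂Hom kk.subtype sfn) ∧
    ∀ a : K, ∃ p : Polynomial K, p ≠ 0 ∧
      (∀ n : ℕ, p.coeff n ∈ Subfield.closure ((kk : Set K) ∪ Set.range sfn)) ∧
      Polynomial.eval a p = 0
  -- `ν` is a rank 1 `𝐤`-valuation with residue field `𝐤`:
  hmul : ∀ f g : K, f ≠ 0 → g ≠ 0 → ν (f * g) = ν f + ν g
  hadd : ∀ f g : K, f ≠ 0 → g ≠ 0 → f + g ≠ 0 → min (ν f) (ν g) ≤ ν (f + g)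
  htriv : ∀ c : K, c ∈ kk → c ≠ 0 → ν c = 0
  hres : ∀ f : K, f ≠ 0 → 0 ≤ ν f → ∃ c ∈ kk, f - c = 0 ∨ 0 < ν (f - c)
  -- `R` is a local subring of `K` containing `𝐤`, with quotient field `K`,
  -- dominated by `ν`:
  hkR : (kk : Set K) ⊆ R
  hfrac : ∀ f : K, ∃ a b : K, a ∈ R ∧ b ∈ R ∧ b ≠ 0 ∧ f = a / b
  hdom : ∀ f ∈ R, f ≠ 0 → 0 ≤ ν f
  hloc : ∀ f ∈ R, f ≠ 0 → ν f = 0 → f⁻¹ ∈ R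
  -- `R` is regular of dimension 3 with regular parameters `x, y, z`, and
  -- `0 < ν(x) ≤ ν(y) ≤ ν(z)`:
  hx : x ∈ R
  hy : y ∈ R
  hz : z ∈ R
  hxne : x ≠ 0
  hyne : y ≠ 0
  hzne : z ≠ 0
  hνx : 0 < ν x
  hνxy : ν x ≤ ν y
  hνyz : ν y ≤ ν z
  hdim : ringKrullDim R = ((3 : ℕ) : WithBot ℕ∞)
  hparam : ∀ (f : K) (hf : f ∈ R), f ≠ 0 → 0 < ν f →
    (⟨f, hf⟩ : R) ∈ Ideal.span ({⟨x, hx⟩, ⟨y, hy⟩, ⟨z, hz⟩} : Set R)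
  -- the sequence `{P_j}` of jumping polynomials and its values `β_j = ν(P_j)`:
  hlen : 2 ≤ len
  hPmem : ∀ j : ℕ, 1 ≤ j → (j : ℕ∞) ≤ len → P j ∈ R
  hPne : ∀ j : ℕ, 1 ≤ j → (j : ℕ∞) ≤ len → P j ≠ 0
  hP1 : P 1 = x
  hP2 : P 2 = y
  hβ : ∀ j : ℕ, 1 ≤ j → (j : ℕ∞) ≤ len → β j = ν (P j)
  hq1 : q 1 = ⊤
  hqtop : ∀ j : ℕ, len < (j : ℕ∞) → q j = ⊤
  hq : ∀ j : ℕ, 2 ≤ j → (j : ℕ∞) ≤ len →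
    q j = sInf {u : ℕ∞ | ∃ t : ℕ, u = (t : ℕ∞) ∧ 0 < t ∧ (t : ℝ) * β j ∈ Gr β (j - 1)}
  /-- the sequence `{P_j}` ends at `P_j` exactly when `q_j = ∞` -/
  hlast : ∀ j : ℕ, 2 ≤ j → (j : ℕ∞) ≤ len → (q j = ⊤ ↔ len = (j : ℕ∞))
  /-- the recursion `P_{j+1} = P_j^{q_j} − λ_jP^{L(j)}`, where `(L(j), 0̄)` is irreducible
  with respect to `𝒫_j` with `q_jβ_j = L(j)·β(j−1)` and `λ_j ∈ 𝐤∖{0}` is the residue of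
  `P_j^{q_j}/P^{L(j)}` (so that `ν(P_{j+1}) > q_jβ_j`) -/
  hPrec : ∀ j : ℕ, 2 ≤ j → (j : ℕ∞) ≤ len → ∀ t : ℕ, q j = (t : ℕ∞) →
    ∃ (lam : K) (LL : Vec), lam ∈ kk ∧ lam ≠ 0 ∧ Supp (j - 1) LL ∧
      (∀ l : ℕ, 2 ≤ l → l ≤ j - 1 → ∀ u : ℕ, q l = (u : ℕ∞) → LL l < u) ∧
      (t : ℝ) * β j = wtA β (j - 1) LL ∧
      P (j + 1) = P j ^ t - lam * ∏ l ∈ Finset.Icc 1 (j - 1), P l ^ LL l ∧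
      (t : ℝ) * β j < ν (P (j + 1))
  -- the sequence `{T_i}` of jumping polynomials and its values `γ_i`:
  hTmem : ∀ i : ℕ, 1 ≤ i → T i ∈ R
  hT1 : T 1 = z
  hγ : ∀ i : ℕ, 1 ≤ i → (T i = 0 → γ i = 0) ∧ (T i ≠ 0 → γ i = ν (T i))
  hs0 : s 0 = ⊤
  hsz : ∀ i : ℕ, 1 ≤ i → T i = 0 → s i = 1 ∧ m i = m (i - 1)
  hs : ∀ i : ℕ, 1 ≤ i → T i ≠ 0 →
    s i = sInf {u : ℕ∞ | ∃ t : ℕ, u = (t : ℕ∞) ∧ 0 < t ∧ (t : ℝ) * γ i ∈ GH β γ len (i - 1)}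
  hm0 : m 0 = 1
  hmtop : ∀ i : ℕ, 1 ≤ i → T i ≠ 0 → s i = ⊤ → m i = m (i - 1)
  hmfin : ∀ i : ℕ, 1 ≤ i → T i ≠ 0 → ∀ t : ℕ, s i = (t : ℕ∞) →
    m i = max (m (i - 1))
      (sInf {j : ℕ | 1 ≤ j ∧ (j : ℕ∞) ≤ len ∧ (t : ℝ) * γ i ∈ GrH β γ j (i - 1)})
  hmlen : ∀ i : ℕ, 1 ≤ m i ∧ ((m i : ℕ) : ℕ∞) ≤ len
  -- `δ_i = #𝒟_i` (with `δ_0 = 1`):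
  hδ0 : δ 0 = 1
  hδ : ∀ i : ℕ, 1 ≤ i →
    (DsetR β γ s m (fun n => T n = 0) i
        (TchainR β γ q s m (fun n => T n = 0) i)).Finite ∧
    δ i = (DsetR β γ s m (fun n => T n = 0) i
        (TchainR β γ q s m (fun n => T n = 0) i)).ncard
  /-- the recursion for the `T`-sequence: for each `i` with `T_i ≠ 0` and `s_i < ∞`, the
  elements of `𝒟_i`, enumerated as `(A,C)_1, …, (A,C)_{δ_i}` in increasing order of
  `|(A,C)|`, give `T_{(Σ_{j=0}^{i-1}δ_j)+k} = T_{AC} = P^AT^C − μ_{AC}P^{L(AC)}T^{N(AC)}`,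
  where `(L(AC), N(AC)) ∈ ℕ₀^{m_i} × ℕ₀^{i-1}` is irreducible with respect to `𝒯_i` with
  `|(L(AC), N(AC))| = |(A,C)|` and `μ_{AC} ∈ 𝐤∖{0}` is the residue of
  `P^AT^C/(P^{L(AC)}T^{N(AC)})` (so that `ν(T_{AC}) > |(A,C)|` unless `T_{AC} = 0`) -/
  hTrec : ∀ i : ℕ, 1 ≤ i → T i ≠ 0 → s i ≠ ⊤ →
    ∃ e : ↥(DsetR β γ s m (fun n => T n = 0) i
        (TchainR β γ q s m (fun n => T n = 0) i)) ≃ Fin (δ i),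
      (∀ p p', ((e p : Fin (δ i)) : ℕ) ≤ ((e p' : Fin (δ i)) : ℕ) →
        wt β γ (m i) i p.1 ≤ wt β γ (m i) i p'.1) ∧
      ∀ p, ∃ (LL NN : Vec) (mu : K),
        Supp (m i) LL ∧ Supp (i - 1) NN ∧
        Irr (TchainR β γ q s m (fun n => T n = 0) i) (LL, NN) ∧
        wt β γ (m i) (i - 1) (LL, NN) = wt β γ (m i) i p.1 ∧
        mu ∈ kk ∧ mu ≠ 0 ∧
        T ((∑ j ∈ Finset.range i, δ j) + ((e p : Fin (δ i)) : ℕ) + 1) =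
          (∏ l ∈ Finset.Icc 1 (m i), P l ^ (p : PVec).1 l) *
            (∏ l ∈ Finset.Icc 1 i, T l ^ (p : PVec).2 l) -
          mu * (∏ l ∈ Finset.Icc 1 (m i), P l ^ LL l) *
            (∏ l ∈ Finset.Icc 1 (i - 1), T l ^ NN l) ∧
        (T ((∑ j ∈ Finset.range i, δ j) + ((e p : Fin (δ i)) : ℕ) + 1) = 0 ∨
          wt β γ (m i) i p.1 <
            ν (T ((∑ j ∈ Finset.range i, δ j) + ((e p : Fin (δ i)) : ℕ) + 1)))

namespace RSetup

variable {K : Type} [Field K] (d : RSetup K)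

/-- The monomial `P^A = ∏_{l=1}^{k} P_l^{a_l}`. -/
noncomputable def Pm (k : ℕ) (A : Vec) : K := ∏ l ∈ Finset.Icc 1 k, d.P l ^ A l

/-- The monomial `T^C = ∏_{l=1}^{i} T_l^{c_l}`. -/
noncomputable def Tm (i : ℕ) (C : Vec) : K := ∏ l ∈ Finset.Icc 1 i, d.T l ^ C l

/-- The set `𝒯 = ⋃_i 𝒯_i` of the construction. -/
noncomputable def TF : Set PVec :=
  TfullR d.β d.γ d.q d.s d.m (fun n => d.T n = 0)

/-- The value semigroup `S_R = ν(R∖{0})`. -/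
def SR : Set ℝ := {t : ℝ | ∃ f : K, f ∈ d.R ∧ f ≠ 0 ∧ d.ν f = t}

/-- The valuation ideal `I_σ = {f ∈ R : ν(f) ≥ σ}` (as a subset of `K`). -/
def Iv (σ : ℝ) : Set K := {f : K | f ∈ d.R ∧ (f = 0 ∨ σ ≤ d.ν f)}

/-- The ideal `𝒜_σ` of `R` generated by the monomials `P^AT^C` with `|(A, C)| ≥ σ`
(as a subset of `K`). -/
noncomputable def Av (σ : ℝ) : Set K :=
  {f : K | ∃ (M : ℕ) (g : Fin M → K) (kb ib : Fin M → ℕ) (A C : Fin M → Vec),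
    (∀ e, g e ∈ d.R) ∧ (∀ e, ((kb e : ℕ) : ℕ∞) ≤ d.len) ∧
    (∀ e, Supp (kb e) (A e)) ∧ (∀ e, Supp (ib e) (C e)) ∧
    (∀ e, σ ≤ wt d.β d.γ (kb e) (ib e) (A e, C e)) ∧
    f = ∑ e, g e * (d.Pm (kb e) (A e) * d.Tm (ib e) (C e))}

/-- The ideal `𝒜⁺_σ` of `R` generated by the monomials `P^AT^C` with `|(A, C)| > σ`
(as a subset of `K`). -/
noncomputable def Avplus (σ : ℝ) : Set K :=
  {f : K | ∃ (M : ℕ) (g : Fin M → K) (kb ib : Fin M → ℕ) (A C : Fin M → Vec),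
    (∀ e, g e ∈ d.R) ∧ (∀ e, ((kb e : ℕ) : ℕ∞) ≤ d.len) ∧
    (∀ e, Supp (kb e) (A e)) ∧ (∀ e, Supp (ib e) (C e)) ∧
    (∀ e, σ < wt d.β d.γ (kb e) (ib e) (A e, C e)) ∧
    f = ∑ e, g e * (d.Pm (kb e) (A e) * d.Tm (ib e) (C e))}

end RSetup

end Jump

namespace Jump

lemma Supp.mono {k k' : ℕ} {A : Vec} (hA : Supp k A) (h : k ≤ k') : Supp k' A :=
  fun j hj => hA j (hj.imp_right h.trans_lt)

lemma Supp.add {k : ℕ} {A B : Vec} (hA : Supp k A) (hB : Supp k B) : Supp k (A + B) :=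
  fun j hj => by simp [hA j hj, hB j hj]

lemma Supp.of_le {k : ℕ} {A B : Vec} (hA : Supp k A) (h : B ≤ A) : Supp k B :=
  fun j hj => Nat.le_zero.1 ((h j).trans_eq (hA j hj))

lemma Supp.zero (k : ℕ) : Supp k 0 := fun _ _ => rfl

lemma Supp.unitVec {j : ℕ} (hj : 1 ≤ j) : Supp j (unitVec j) := by
  intro l hl
  have : l ≠ j := by omega
  simp [Jump.unitVec, this]

lemma Supp.index_le {k j : ℕ} {A : Vec} (hA : Supp k A) (h : 0 < A j) : j ≤ k := by
  by_contra! hj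
  exact h.ne' (hA j (Or.inr hj))

lemma wtA_add (β : ℕ → ℝ) (k : ℕ) (A B : Vec) :
    wtA β k (A + B) = wtA β k A + wtA β k B := by
  simp [wtA, add_mul, Finset.sum_add_distrib]

lemma wtA_extend (β : ℕ → ℝ) {k k' : ℕ} {A : Vec} (hA : Supp k A) (h : k ≤ k') :
    wtA β k' A = wtA β k A := by
  refine (Finset.sum_subset (Finset.Icc_subset_Icc_right h) fun l _ hl => ?_).symm
  have : A l = 0 := hA l (by simp only [Finset.mem_Icc] at hl; omega)
  simp [this]

lemma wtA_zero (β : ℕ → ℝ) (k : ℕ) : wtA β k 0 = 0 := by simp [wtA]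

lemma wtA_mul_unitVec (β : ℕ → ℝ) {j k : ℕ} (hj : 1 ≤ j) (hjk : j ≤ k) (t : ℕ) :
    wtA β k (fun l => t * unitVec j l) = t * β j := by
  rw [wtA, Finset.sum_eq_single j]
  · simp [unitVec]
  · intro l _ hl
    simp [unitVec, hl]
  · intro h
    exact absurd (Finset.mem_Icc.2 ⟨hj, hjk⟩) h

lemma wtA_unitVec (β : ℕ → ℝ) {j k : ℕ} (hj : 1 ≤ j) (hjk : j ≤ k) :
    wtA β k (unitVec j) = β j := by
  simpa using wtA_mul_unitVec β hj hjk 1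

lemma wt_add (β γ : ℕ → ℝ) (k i : ℕ) (A B C D : Vec) :
    wt β γ k i (A + B, C + D) = wt β γ k i (A, C) + wt β γ k i (B, D) := by
  simp only [wt, wtA_add]
  ring

lemma wt_extend (β γ : ℕ → ℝ) {k k' i i' : ℕ} {A C : Vec} (hA : Supp k A) (hC : Supp i C)
    (hk : k ≤ k') (hi : i ≤ i') : wt β γ k' i' (A, C) = wt β γ k i (A, C) := by
  simp only [wt, wtA_extend β hA hk, wtA_extend γ hC hi]

/-- The relation comparing tuples by the largest index at which they differ. -/
def TopLex (n : ℕ) (A B : Vec) : Prop := ∃ j ≤ n, A j < B j ∧ ∀ l, j < l → A l = B l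

lemma TopLex.add_left {n : ℕ} {A B : Vec} (h : TopLex n A B) (E : Vec) :
    TopLex n (E + A) (E + B) := by
  obtain ⟨j, hj, hlt, heq⟩ := h
  exact ⟨j, hj, by simpa using hlt, fun l hl => by simp [heq l hl]⟩

lemma topLex_wellFounded (n : ℕ) : WellFounded (TopLex n) := by
  have hwf : WellFounded
      (Pi.Lex (β := fun _ : Fin (n + 1) => ℕ) (· > ·) (fun {_} => (· < ·))) :=
    Pi.Lex.wellFounded (· > ·) fun _ => wellFounded_lt
  refine Subrelation.wf ?_ (InvImage.wf (fun (A : Vec) (l : Fin (n + 1)) => A l) hwf)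
  rintro A B ⟨j, hj, hlt, heq⟩
  exact ⟨⟨j, by omega⟩, fun l hl => heq l hl, hlt⟩

section Monomials

variable {K : Type} [Field K] (d : RSetup K)

lemma prod_pow_extend (F : ℕ → K) {k k' : ℕ} {A : Vec} (hA : Supp k A) (h : k ≤ k') :
    ∏ l ∈ Finset.Icc 1 k', F l ^ A l = ∏ l ∈ Finset.Icc 1 k, F l ^ A l := by
  refine (Finset.prod_subset (Finset.Icc_subset_Icc_right h) fun l _ hl => ?_).symm
  have : A l = 0 := hA l (by simp only [Finset.mem_Icc] at hl; omega)
  simp [this]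

lemma prod_pow_mul_unitVec (F : ℕ → K) {j k : ℕ} (hj : 1 ≤ j) (hjk : j ≤ k) (t : ℕ) :
    ∏ l ∈ Finset.Icc 1 k, F l ^ (t * unitVec j l) = F j ^ t := by
  rw [Finset.prod_eq_single j]
  · simp [unitVec]
  · intro l _ hl
    simp [unitVec, hl]
  · intro h
    exact absurd (Finset.mem_Icc.2 ⟨hj, hjk⟩) h

lemma prod_pow_unitVec (F : ℕ → K) {j k : ℕ} (hj : 1 ≤ j) (hjk : j ≤ k) :
    ∏ l ∈ Finset.Icc 1 k, F l ^ unitVec j l = F j := by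
  simpa using prod_pow_mul_unitVec F hj hjk 1

namespace RSetup

lemma Pm_add (k : ℕ) (A B : Vec) : d.Pm k (A + B) = d.Pm k A * d.Pm k B := by
  simp [Pm, pow_add, Finset.prod_mul_distrib]

lemma Tm_add (i : ℕ) (C D : Vec) : d.Tm i (C + D) = d.Tm i C * d.Tm i D := by
  simp [Tm, pow_add, Finset.prod_mul_distrib]

lemma Pm_zero (k : ℕ) : d.Pm k 0 = 1 := by simp [Pm]

lemma Tm_zero (i : ℕ) : d.Tm i 0 = 1 := by simp [Tm]

lemma zero_mem_Avplus (σ : ℝ) : (0 : K) ∈ d.Avplus σ :=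
  ⟨0, fun _ => 0, fun _ => 0, fun _ => 0, fun _ => 0, fun _ => 0, fun e => e.elim0,
    fun e => e.elim0, fun e => e.elim0, fun e => e.elim0, fun e => e.elim0, by simp⟩

lemma monomial_mem_Avplus {σ : ℝ} {k i : ℕ} {A C : Vec} (hk : (k : ℕ∞) ≤ d.len)
    (hA : Supp k A) (hC : Supp i C) (h : σ < wt d.β d.γ k i (A, C)) :
    d.Pm k A * d.Tm i C ∈ d.Avplus σ :=
  ⟨1, fun _ => 1, fun _ => k, fun _ => i, fun _ => A, fun _ => C, fun _ => d.R.one_mem,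
    fun _ => hk, fun _ => hA, fun _ => hC, fun _ => h, by simp⟩

lemma add_mem_Avplus {σ : ℝ} {f g : K} (hf : f ∈ d.Avplus σ) (hg : g ∈ d.Avplus σ) :
    f + g ∈ d.Avplus σ := by
  obtain ⟨M, a, kb, ib, A, C, h1, h2, h3, h4, h5, rfl⟩ := hf
  obtain ⟨M', a', kb', ib', A', C', h1', h2', h3', h4', h5', rfl⟩ := hg
  refine ⟨M + M', Fin.append a a', Fin.append kb kb', Fin.append ib ib', Fin.append A A',
    Fin.append C C', ?_, ?_, ?_, ?_, ?_, ?_⟩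
  · exact fun e => Fin.addCases (by simpa using h1) (by simpa using h1') e
  · exact fun e => Fin.addCases (by simpa using h2) (by simpa using h2') e
  · exact fun e => Fin.addCases (by simpa using h3) (by simpa using h3') e
  · exact fun e => Fin.addCases (by simpa using h4) (by simpa using h4') e
  · exact fun e => Fin.addCases (by simpa using h5) (by simpa using h5') e
  · simp [Fin.sum_univ_add]

lemma mul_mem_Avplus {σ : ℝ} {c f : K} (hc : c ∈ d.R) (hf : f ∈ d.Avplus σ) :
    c * f ∈ d.Avplus σ := by
  obtain ⟨M, a, kb, ib, A, C, h1, h2, h3, h4, h5, rfl⟩ := hf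
  refine ⟨M, fun e => c * a e, kb, ib, A, C, fun e => d.R.mul_mem hc (h1 e), h2, h3, h4, h5, ?_⟩
  simp only [Finset.mul_sum, mul_assoc]

lemma monomial_mul_mem_Avplus {σ : ℝ} {k i : ℕ} {A C : Vec} {f : K} (hk : (k : ℕ∞) ≤ d.len)
    (hA : Supp k A) (hC : Supp i C) (hf : f ∈ d.Avplus σ) :
    d.Pm k A * d.Tm i C * f ∈ d.Avplus (wt d.β d.γ k i (A, C) + σ) := by
  obtain ⟨M, a, kb, ib, B, D, h1, h2, h3, h4, h5, rfl⟩ := hf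
  refine ⟨M, a, fun e => max k (kb e), fun e => max i (ib e), fun e => A + B e,
    fun e => C + D e, h1, fun e => ?_,
    fun e => (hA.mono (le_max_left _ _)).add ((h3 e).mono (le_max_right _ _)),
    fun e => (hC.mono (le_max_left _ _)).add ((h4 e).mono (le_max_right _ _)), fun e => ?_, ?_⟩
  · dsimp only
    rcases max_choice k (kb e) with h | h <;> rw [h]
    exacts [hk, h2 e]
  · rw [wt_add, wt_extend _ _ hA hC (le_max_left _ _) (le_max_left _ _),
      wt_extend _ _ (h3 e) (h4 e) (le_max_right _ _) (le_max_right _ _)]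
    linarith [h5 e]
  · rw [Finset.mul_sum]
    refine Finset.sum_congr rfl fun e _ => ?_
    rw [Pm_add, Tm_add]
    simp only [Pm, Tm]
    rw [prod_pow_extend _ hA (le_max_left _ _), prod_pow_extend _ (h3 e) (le_max_right _ _),
      prod_pow_extend _ hC (le_max_left _ _), prod_pow_extend _ (h4 e) (le_max_right _ _)]
    ring

lemma m_le_succ (i : ℕ) : d.m i ≤ d.m (i + 1) := by
  have h1 : 1 ≤ i + 1 := by omega
  by_cases hz : d.T (i + 1) = 0
  · exact (d.hsz _ h1 hz).2.ge
  · cases hs : d.s (i + 1) with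
    | top => exact (d.hmtop _ h1 hz hs).ge
    | coe t =>
      rw [d.hmfin _ h1 hz t hs]
      exact le_max_left _ _

lemma m_mono : Monotone d.m := monotone_nat_of_le_succ d.m_le_succ

/-- A member of `𝒯` is the leading pair of a rewriting rule: its monomial equals, up to
terms of larger weight, a multiple of a monomial of the same weight that is smaller for the
lexicographic order. -/
def HasRewrite (k i : ℕ) (p : PVec) : Prop :=
  ∃ (L N : Vec) (θ r : K), Supp k L ∧ Supp i N ∧ θ ∈ d.kk ∧
    r ∈ d.Avplus (wt d.β d.γ k i p) ∧ wt d.β d.γ k i (L, N) = wt d.β d.γ k i p ∧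
    d.Pm k p.1 * d.Tm i p.2 = θ * (d.Pm k L * d.Tm i N) + r ∧
    (TopLex i N p.2 ∨ N = p.2 ∧ TopLex k L p.1)

lemma q_pos {j t : ℕ} (hj : 2 ≤ j) (hjl : (j : ℕ∞) ≤ d.len) (ht : d.q j = t) :
    0 < t := by
  have hq := d.hq j hj hjl
  have hne : {u : ℕ∞ | ∃ t : ℕ, u = (t : ℕ∞) ∧ 0 < t ∧
      (t : ℝ) * d.β j ∈ Gr d.β (j - 1)}.Nonempty := by
    by_contra h
    rw [Set.not_nonempty_iff_eq_empty] at h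
    rw [h, sInf_empty, ht] at hq
    exact ENat.natCast_ne_top t hq
  obtain ⟨u, hu, hu0, -⟩ := csInf_mem hne
  rw [← hq, ht] at hu
  exact (Nat.cast_injective hu : t = u) ▸ hu0

lemma hasRewrite_of_mem_Pset {k i : ℕ} {p : PVec} (hp : p ∈ Pset d.q) (hpk : Supp k p.1) :
    d.HasRewrite k i p := by
  obtain ⟨j, hj, t, ht, rfl⟩ := hp
  have hjl : (j : ℕ∞) ≤ d.len := by
    by_contra! h
    exact ENat.natCast_ne_top t (ht.symm.trans (d.hqtop j h))
  have ht0 := d.q_pos hj hjl ht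
  have hjk : j ≤ k := hpk.index_le (by simpa [unitVec] using ht0)
  have hj1l : ((j + 1 : ℕ) : ℕ∞) ≤ d.len := by
    have hne : d.len ≠ j := fun h =>
      ENat.natCast_ne_top t (ht.symm.trans ((d.hlast j hj hjl).2 h))
    exact_mod_cast Order.add_one_le_of_lt (lt_of_le_of_ne hjl hne.symm)
  obtain ⟨lam, LL, hlam, -, hLL, -, hw, hP, hν⟩ := d.hPrec j hj hjl t ht
  have hwp : wt d.β d.γ k i (fun l => t * unitVec j l, fun _ => 0) = t * d.β j := by
    have h0 := wtA_zero d.γ i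
    simp only [wt, wtA_mul_unitVec d.β (by omega : 1 ≤ j) hjk]
    exact add_eq_left.2 h0
  refine ⟨LL, fun _ => 0, lam, d.P (j + 1), hLL.mono (by omega), Supp.zero i, hlam, ?_, ?_, ?_,
    Or.inr ⟨rfl, j, hjk, ?_, fun l hl => ?_⟩⟩
  · rw [hwp]
    have h := d.monomial_mem_Avplus (σ := t * d.β j) hj1l
      (Supp.unitVec (by omega : 1 ≤ j + 1)) (Supp.zero 0) (by
        simpa [wt, wtA_unitVec d.β (by omega : 1 ≤ j + 1) le_rfl, wtA_zero,
          d.hβ _ (by omega : 1 ≤ j + 1) hj1l] using hν)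
    rwa [Tm_zero, mul_one, Pm, prod_pow_unitVec _ (by omega) le_rfl] at h
  · rw [hwp, hw, wt, wtA_extend _ hLL (by omega : j - 1 ≤ k)]
    exact add_eq_left.2 (wtA_zero d.γ i)
  · simp only [Pm, Tm, prod_pow_mul_unitVec _ (by omega : 1 ≤ j) hjk,
      prod_pow_extend _ hLL (by omega : j - 1 ≤ k), hP]
    simp
  · simpa [unitVec, hLL j (Or.inr (by omega))] using ht0
  · simp [unitVec, hLL l (Or.inr (by omega)), hl.ne']

lemma hasRewrite_of_T_eq_zero {k i n : ℕ} (hn : 1 ≤ n) (hni : n ≤ i) (hz : d.T n = 0) :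
    d.HasRewrite k i (fun _ => 0, unitVec n) := by
  refine ⟨0, 0, 0, 0, Supp.zero k, Supp.zero i, d.kk.zero_mem, d.zero_mem_Avplus _, ?_, ?_,
    Or.inl ⟨n, hni, by simp [unitVec], fun l hl => by simp [unitVec, hl.ne']⟩⟩
  · have hA : wtA d.β k (fun _ => 0) = 0 := wtA_zero d.β k
    simp [wt, wtA_unitVec d.γ hn hni, (d.hγ n hn).1 hz, wtA_zero, hA]
  · simp [Tm, prod_pow_unitVec d.T hn hni, hz]

lemma hasRewrite_of_mem_Dstep {k i n : ℕ} {p : PVec} (hmk : d.m i ≤ k) (hn : 1 ≤ n)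
    (hpi : Supp i p.2) (hz : d.T n ≠ 0)
    (hp : p ∈ Dstep d.β d.γ d.s d.m n (TchainR d.β d.γ d.q d.s d.m (fun n => d.T n = 0) n)) :
    d.HasRewrite k i p := by
  have hs : d.s n ≠ ⊤ := by
    intro h
    simp [Dstep, h] at hp
  obtain ⟨e, -, he⟩ := d.hTrec n hn hz hs
  have hp' : p ∈ DsetR d.β d.γ d.s d.m (fun n => d.T n = 0) n
      (TchainR d.β d.γ d.q d.s d.m (fun n => d.T n = 0) n) := by
    simpa [DsetR, hz] using hp
  obtain ⟨LL, NN, mu, hLL, hNN, -, hw, hmu, -, hT, hν⟩ := he ⟨p, hp'⟩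
  obtain ⟨hp1, hp2, -, ⟨hpos, -⟩, -⟩ : Supp (d.m n) p.1 ∧ Supp n p.2 ∧ Irr _ p ∧
      Red d.β d.γ (d.m n) n p := by
    simpa [Dstep, hs] using hp
  have hni : n ≤ i := hpi.index_le hpos
  have hmn : d.m n ≤ k := (d.m_mono hni).trans hmk
  have hwp : wt d.β d.γ k i p = wt d.β d.γ (d.m n) n p := wt_extend _ _ hp1 hp2 hmn hni
  dsimp only at hT hν hw
  set u := (∑ j ∈ Finset.range n, d.δ j) + ((e ⟨p, hp'⟩ : Fin (d.δ n)) : ℕ) + 1 with hu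
  have hu1 : 1 ≤ u := by omega
  refine ⟨LL, NN, mu, d.T u, hLL.mono hmn, hNN.mono (by omega), hmu, ?_, ?_, ?_,
    Or.inl ⟨n, hni, ?_, fun l hl => ?_⟩⟩
  · by_cases hTu : d.T u = 0
    · rw [hTu]
      exact d.zero_mem_Avplus _
    · have h := d.monomial_mem_Avplus (σ := wt d.β d.γ k i p) (k := 0) (i := u) (by simp)
        (Supp.zero 0) (Supp.unitVec hu1) (by
          rw [hwp]
          simpa [wt, wtA_unitVec d.γ hu1 le_rfl, wtA_zero, (d.hγ u hu1).2 hTu]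
            using hν.resolve_left hTu)
      rwa [Pm_zero, one_mul, Tm, prod_pow_unitVec _ hu1 le_rfl] at h
  · rw [hwp, ← hw]
    exact wt_extend _ _ hLL hNN hmn (by omega)
  · rw [hT]
    simp only [Pm, Tm, prod_pow_extend _ hLL hmn, prod_pow_extend _ hp1 hmn,
      prod_pow_extend _ hp2 hni, prod_pow_extend _ hNN (by omega : n - 1 ≤ i)]
    ring
  · simpa [hNN n (Or.inr (by omega))] using hpos
  · rw [hNN l (Or.inr (by omega)), hp2 l (Or.inr hl)]

lemma mem_TchainR {n : ℕ} {p : PVec}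
    (hp : p ∈ TchainR d.β d.γ d.q d.s d.m (fun n => d.T n = 0) n) :
    p ∈ Pset d.q ∨ ∃ n', p ∈ Astep d.β d.γ d.s d.m (fun n => d.T n = 0) n'
      (TchainR d.β d.γ d.q d.s d.m (fun n => d.T n = 0) n') := by
  induction n with
  | zero => exact Or.inl hp
  | succ n ih => exact hp.elim ih fun h => Or.inr ⟨n, h⟩

lemma hasRewrite_of_mem_TF {k i : ℕ} {p : PVec} (hmk : d.m i ≤ k) (hp : p ∈ d.TF)
    (hpk : Supp k p.1) (hpi : Supp i p.2) : d.HasRewrite k i p := by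
  obtain ⟨n, hn⟩ := Set.mem_iUnion.1 hp
  obtain h | ⟨n', h⟩ := d.mem_TchainR hn
  · exact d.hasRewrite_of_mem_Pset h hpk
  · unfold Astep at h
    split_ifs at h with h0 hz
    · exact h.elim
    · obtain rfl : p = _ := h
      have hni : n' ≤ i := hpi.index_le (by simp [unitVec])
      exact d.hasRewrite_of_T_eq_zero (by omega) hni hz
    · exact d.hasRewrite_of_mem_Dstep hmk (by omega) hpi hz h

lemma exists_irreducible {k i : ℕ} (hk : (k : ℕ∞) ≤ d.len) (hmk : d.m i ≤ k) (p : Vec × Vec)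
    (hA : Supp k p.2) (hC : Supp i p.1) :
    ∃ (B D : Vec) (θ f : K), Supp k B ∧ Supp i D ∧ θ ∈ d.kk ∧
      f ∈ d.Avplus (wt d.β d.γ k i (p.2, p.1)) ∧
      wt d.β d.γ k i (B, D) = wt d.β d.γ k i (p.2, p.1) ∧ Irr d.TF (B, D) ∧
      d.Pm k p.2 * d.Tm i p.1 = θ * (d.Pm k B * d.Tm i D) + f := by
  induction p using ((topLex_wellFounded i).prod_lex (topLex_wellFounded k)).induction with
  | _ p ih =>
  obtain ⟨C, A⟩ := p
  by_cases hirr : Irr d.TF (A, C)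
  · exact ⟨A, C, 1, 0, hA, hC, d.kk.one_mem, d.zero_mem_Avplus _, rfl, hirr, by simp⟩
  · simp only [Irr, not_forall, not_not] at hirr
    obtain ⟨⟨B, D⟩, hmem, hBA, hDC⟩ := hirr
    obtain ⟨L, N, θ, r, hL, hN, hθ, hr, hw, heq, hlt⟩ :=
      d.hasRewrite_of_mem_TF hmk hmem (hA.of_le hBA) (hC.of_le hDC)
    dsimp only at hBA hDC hA hC heq hlt
    obtain ⟨A', rfl⟩ : ∃ A' : Vec, A = A' + B := ⟨A - B, (tsub_add_cancel_of_le hBA).symm⟩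
    obtain ⟨C', rfl⟩ : ∃ C' : Vec, C = C' + D := ⟨C - D, (tsub_add_cancel_of_le hDC).symm⟩
    have hA' : Supp k A' := hA.of_le le_self_add
    have hC' : Supp i C' := hC.of_le le_self_add
    have hstep : Prod.Lex (TopLex i) (TopLex k) (C' + N, A' + L) (C' + D, A' + B) := by
      rcases hlt with h | ⟨rfl, h⟩
      · exact Prod.Lex.left _ _ (h.add_left C')
      · exact Prod.Lex.right _ (h.add_left A')
    obtain ⟨B', D', θ', f, hB', hD', hθ', hf, hw', hirr', heq'⟩ :=
      ih _ hstep (hA'.add hL) (hC'.add hN)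
    have hσ : wt d.β d.γ k i (A' + L, C' + N) = wt d.β d.γ k i (A' + B, C' + D) := by
      rw [wt_add, wt_add, hw]
    dsimp only at hf hw' heq' ⊢
    rw [hσ] at hf hw'
    refine ⟨B', D', θ * θ', θ * f + d.Pm k A' * d.Tm i C' * r, hB', hD',
      d.kk.mul_mem hθ hθ', ?_, hw', hirr', ?_⟩
    · refine d.add_mem_Avplus (d.mul_mem_Avplus (d.hkR hθ) hf) ?_
      rw [wt_add]
      exact d.monomial_mul_mem_Avplus hk hA' hC' hr
    · rw [Pm_add, Tm_add] at heq' ⊢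
      linear_combination d.Pm k A' * d.Tm i C' * heq + θ * heq'

end RSetup

end Monomials

/-- Lemma 5.2. For `(A, C) ∈ ℕ₀^k × ℕ₀^i`, `σ = |(A, C)|` and
`m = max(k, m_i)`, there exist `(B, D) ∈ ℕ₀^m × ℕ₀^i`, `θ ∈ 𝐤` and `f ∈ 𝒜⁺_σ` with
`|(B, D)| = σ`, `(B, D)` irreducible with respect to `𝒯`, and
`P^AT^C = θP^BT^D + f` in `R`. -/
theorem monomial_reduction {K : Type} [Field K] (d : RSetup K) (k i : ℕ)
    (hk : 1 ≤ k) (hkl : (k : ℕ∞) ≤ d.len) (A C : Vec) (hA : Supp k A) (hC : Supp i C) :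
    ∃ (B D : Vec) (θ f : K),
      Supp (max k (d.m i)) B ∧ Supp i D ∧ θ ∈ d.kk ∧
      f ∈ d.Avplus (wt d.β d.γ k i (A, C)) ∧
      wt d.β d.γ (max k (d.m i)) i (B, D) = wt d.β d.γ k i (A, C) ∧
      Irr d.TF (B, D) ∧
      d.Pm k A * d.Tm i C = θ * (d.Pm (max k (d.m i)) B * d.Tm i D) + f := by
  have hlen : ((max k (d.m i) : ℕ) : ℕ∞) ≤ d.len := by
    rcases max_choice k (d.m i) with h | h <;> rw [h]
    exacts [hkl, (d.hmlen i).2]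
  have hkM : k ≤ max k (d.m i) := le_max_left _ _
  have h := d.exists_irreducible hlen (le_max_right k (d.m i)) (C, A) (hA.mono hkM) hC
  dsimp only at h
  rw [wt_extend _ _ hA hC hkM le_rfl] at h
  have hP : d.Pm (max k (d.m i)) A = d.Pm k A := prod_pow_extend _ hA hkM
  rwa [hP] at h

end Jump
end

section
/- Suppose k ∈ ℕ and i ∈ ℕ₀. If (A,C) ∈ ℕ₀^k × ℕ₀^i and (B,D) ∈ ℕ₀^k × ℕ₀^i are both irreducible with respect to 𝒯_{i+1} and |(A,C)| = |(B,D)|, then (A,C) = (B,D). -/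
namespace Jump

/-- The group `G_n`, bundled. -/
noncomputable def grSubgroup (β : ℕ → ℝ) (n : ℕ) : AddSubgroup ℝ where
  carrier := Gr β n
  zero_mem' := ⟨0, fun _ _ => rfl, by simp [wtZ]⟩
  add_mem' := by
    rintro _ _ ⟨A, hA, rfl⟩ ⟨B, hB, rfl⟩
    exact ⟨A + B, fun j hj => by simp [hA j hj, hB j hj],
      by simp [wtZ, add_mul, Finset.sum_add_distrib]⟩
  neg_mem' := by
    rintro _ ⟨A, hA, rfl⟩
    exact ⟨-A, fun j hj => by simp [hA j hj], by simp [wtZ]⟩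

theorem mem_grSubgroup {β : ℕ → ℝ} {n : ℕ} {x : ℝ} : x ∈ grSubgroup β n ↔ x ∈ Gr β n :=
  Iff.rfl

theorem wtA_succ (β : ℕ → ℝ) (n : ℕ) (A : Vec) :
    wtA β (n + 1) A = wtA β n A + A (n + 1) * β (n + 1) := by
  simp [wtA, Finset.sum_Icc_succ_top]

theorem wtA_congr (β : ℕ → ℝ) {n : ℕ} {A B : Vec} (h : ∀ j, 1 ≤ j → j ≤ n → A j = B j) :
    wtA β n A = wtA β n B :=
  Finset.sum_congr rfl fun j hj => by
    rw [h j (Finset.mem_Icc.1 hj).1 (Finset.mem_Icc.1 hj).2]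

theorem wtA_eq_of_supp (β : ℕ → ℝ) {n k : ℕ} {A : Vec} (hnk : n ≤ k)
    (h : ∀ j, n < j → j ≤ k → A j = 0) : wtA β k A = wtA β n A := by
  refine (Finset.sum_subset (Finset.Icc_subset_Icc_right hnk) fun j hj hj' => ?_).symm
  simp only [Finset.mem_Icc, not_and, not_le] at hj hj'
  simp [h j (hj' hj.1) hj.2]

theorem wtA_mem_grSubgroup (β : ℕ → ℝ) (n : ℕ) (A : Vec) : wtA β n A ∈ grSubgroup β n := by
  refine ⟨fun j => if 1 ≤ j ∧ j ≤ n then A j else 0, fun j hj => if_neg (by omega), ?_⟩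
  refine Finset.sum_congr rfl fun j hj => ?_
  simp [Finset.mem_Icc.1 hj]

theorem mem_grSubgroup_succ {β : ℕ → ℝ} {n : ℕ} {x : ℝ} :
    x ∈ grSubgroup β (n + 1) ↔ ∃ c : ℤ, ∃ y ∈ grSubgroup β n, x = c * β (n + 1) + y := by
  constructor
  · rintro ⟨A, -, rfl⟩
    refine ⟨A (n + 1), wtZ β n A, ?_, by simp [wtZ, Finset.sum_Icc_succ_top, add_comm]⟩
    refine ⟨fun j => if 1 ≤ j ∧ j ≤ n then A j else 0, fun j hj => if_neg (by omega), ?_⟩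
    refine Finset.sum_congr rfl fun j hj => ?_
    simp [Finset.mem_Icc.1 hj]
  · rintro ⟨c, _, ⟨A, hA, rfl⟩, rfl⟩
    refine ⟨fun j => if j = n + 1 then c else A j, fun j hj => ?_, ?_⟩
    · exact (if_neg (by omega)).trans (hA j (by omega))
    · simp only [wtZ, Finset.sum_Icc_succ_top (Nat.le_add_left 1 n), if_true]
      rw [add_comm]
      congr 1
      refine Finset.sum_congr rfl fun j hj => ?_
      rw [if_neg (by have := (Finset.mem_Icc.1 hj).2; omega)]

theorem grSubgroup_mono (β : ℕ → ℝ) : Monotone (grSubgroup β) :=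
  monotone_nat_of_le_succ fun _ x hx => mem_grSubgroup_succ.2 ⟨0, x, hx, by simp⟩

theorem grSubgroup_zero (β : ℕ → ℝ) : grSubgroup β 0 = ⊥ := by
  refine (AddSubgroup.eq_bot_iff_forall _).2 ?_
  rintro _ ⟨A, -, rfl⟩
  simp [wtZ]

theorem mem_GrH_iff {β γ : ℕ → ℝ} {k i : ℕ} {x : ℝ} :
    x ∈ GrH β γ k i ↔ x ∈ grSubgroup β k ⊔ grSubgroup γ i := by
  simp only [AddSubgroup.mem_sup, mem_grSubgroup, GrH, Set.mem_ofPred_eq, eq_comm]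

/-- The group `G + H_i`, bundled. -/
noncomputable def ghSubgroup (β γ : ℕ → ℝ) (len : ℕ∞) (i : ℕ) : AddSubgroup ℝ where
  carrier := GH β γ len i
  zero_mem' := ⟨0, by simp, mem_GrH_iff.2 (zero_mem _)⟩
  add_mem' := by
    rintro x y ⟨k, hk, hx⟩ ⟨l, hl, hy⟩
    refine ⟨max k l, by rcases max_choice k l with h | h <;> rwa [h], mem_GrH_iff.2 ?_⟩
    exact add_mem
      (sup_le_sup_right (grSubgroup_mono β (le_max_left k l)) _ (mem_GrH_iff.1 hx))
      (sup_le_sup_right (grSubgroup_mono β (le_max_right k l)) _ (mem_GrH_iff.1 hy))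
  neg_mem' := by
    rintro x ⟨k, hk, hx⟩
    exact ⟨k, hk, mem_GrH_iff.2 (neg_mem (mem_GrH_iff.1 hx))⟩

theorem sup_le_ghSubgroup (β γ : ℕ → ℝ) {len : ℕ∞} {k : ℕ} (i : ℕ) (hk : (k : ℕ∞) ≤ len) :
    grSubgroup β k ⊔ grSubgroup γ i ≤ ghSubgroup β γ len i :=
  fun _ hx => ⟨k, hk, mem_GrH_iff.2 hx⟩

/-- If `s` is the order of `g` modulo the subgroup `K`, then every integer multiple of `g` in `K`
is trivial or is a multiple by a multiple of `s`. -/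
theorem eq_zero_or_dvd_of_mul_mem (K : AddSubgroup ℝ) {g : ℝ} {s : ℕ∞}
    (hs : s = sInf {x : ℕ∞ | ∃ t : ℕ, x = (t : ℕ∞) ∧ 0 < t ∧ (t : ℝ) * g ∈ K})
    {x : ℤ} (hx : (x : ℝ) * g ∈ K) :
    x = 0 ∨ ∃ t : ℕ, s = (t : ℕ∞) ∧ 0 < t ∧ (t : ℝ) * g ∈ K ∧ (t : ℤ) ∣ x := by
  refine or_iff_not_imp_left.2 fun hx0 => ?_
  have key : ∀ y : ℤ, 0 < y → (y : ℝ) * g ∈ K → s ≤ (y.toNat : ℕ∞) := fun y hy hyK => by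
    rw [hs]
    refine sInf_le ⟨y.toNat, rfl, by omega, ?_⟩
    have : ((y.toNat : ℕ) : ℝ) = (y : ℝ) := by
      exact_mod_cast congrArg (Int.cast : ℤ → ℝ) (Int.toNat_of_nonneg hy.le)
    rwa [this]
  have hmem : s ∈ {x : ℕ∞ | ∃ t : ℕ, x = (t : ℕ∞) ∧ 0 < t ∧ (t : ℝ) * g ∈ K} := by
    rw [hs]
    refine csInf_mem ⟨(x.natAbs : ℕ∞), x.natAbs, rfl, by omega, ?_⟩
    rw [Nat.cast_natAbs, Int.cast_abs]
    rcases abs_choice (x : ℝ) with h | h <;> rw [h]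
    · exact hx
    · simpa using neg_mem hx
  obtain ⟨t, hst, ht, htK⟩ := hmem
  refine ⟨t, hst, ht, htK, Int.dvd_of_emod_eq_zero ?_⟩
  by_contra hne
  have hpos : 0 < x % t := lt_of_le_of_ne (Int.emod_nonneg _ (by omega)) (Ne.symm hne)
  have hlt : x % t < t := Int.emod_lt_of_pos _ (by omega)
  have hmod : ((x % t : ℤ) : ℝ) * g ∈ K := by
    have h := sub_mem hx (zsmul_mem htK (x / t))
    have e : ((x % t : ℤ) : ℝ) = x - t * (x / t : ℤ) := by
      rw [Int.emod_def]; push_cast; ring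
    rw [e]
    convert h using 1
    rw [zsmul_eq_mul]; ring
  have := key _ hpos hmod
  rw [hst] at this
  have : t ≤ (x % t).toNat := by exact_mod_cast this
  omega

theorem Setup.one_le_len (d : Setup) : ((1 : ℕ) : ℕ∞) ≤ d.len :=
  le_trans (by norm_num) d.hlen

theorem Setup.m_le_succ (d : Setup) (i : ℕ) : d.m i ≤ d.m (i + 1) := by
  rcases eq_or_ne (d.s (i + 1)) ⊤ with h | h
  · exact (d.hmtop (i + 1) (by omega) h).ge
  · obtain ⟨t, ht⟩ := ENat.ne_top_iff_exists.1 h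
    rw [d.hmfin (i + 1) (by omega) t ht.symm]
    exact le_max_left _ _

theorem Setup.mul_mem_sup (d : Setup) {i : ℕ} {c : ℤ}
    (hc : (c : ℝ) * d.γ (i + 1) ∈ ghSubgroup d.β d.γ d.len i) :
    c = 0 ∨ d.s (i + 1) ≠ ⊤ ∧
      (c : ℝ) * d.γ (i + 1) ∈ grSubgroup d.β (d.m (i + 1)) ⊔ grSubgroup d.γ i := by
  refine (eq_zero_or_dvd_of_mul_mem _ (d.hs (i + 1) (by omega)) hc).imp_right ?_
  rintro ⟨t, hst, -, htK, z, rfl⟩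
  refine ⟨by simp [hst], ?_⟩
  have hne : {j : ℕ | 1 ≤ j ∧ (j : ℕ∞) ≤ d.len ∧
      (t : ℝ) * d.γ (i + 1) ∈ GrH d.β d.γ j (i + 1 - 1)}.Nonempty := by
    obtain ⟨k, hk, hx⟩ := htK
    refine ⟨max k 1, le_max_right _ _, ?_, mem_GrH_iff.2 ?_⟩
    · rcases max_choice k 1 with h | h <;> rw [h]
      exacts [hk, d.one_le_len]
    · exact sup_le_sup_right (grSubgroup_mono _ (le_max_left k 1)) _ (mem_GrH_iff.1 hx)
  have hm := sup_le_sup_right (grSubgroup_mono d.β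
    (d.hmfin (i + 1) (by omega) t hst ▸ le_max_right _ _)) _
    (mem_GrH_iff.1 (Nat.sInf_mem hne).2.2)
  have := zsmul_mem hm z
  rw [zsmul_eq_mul] at this
  rwa [Int.cast_mul, Int.cast_natCast, mul_comm (t : ℝ), mul_assoc]

theorem Setup.mem_grSubgroup_of_mem_sup (d : Setup) {N n : ℕ} (hN : (N : ℕ∞) ≤ d.len)
    (hn : (n : ℕ∞) ≤ d.len) {i : ℕ} (hm : d.m i ≤ n) {x : ℝ} (hxN : x ∈ grSubgroup d.β N)
    (hx : x ∈ grSubgroup d.β n ⊔ grSubgroup d.γ i) : x ∈ grSubgroup d.β n := by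
  induction i with
  | zero => simpa [grSubgroup_zero] using hx
  | succ i ih =>
    refine ih ((d.m_le_succ i).trans hm) ?_
    obtain ⟨a, ha, y, hy, rfl⟩ := AddSubgroup.mem_sup.1 hx
    obtain ⟨c, b, hb, rfl⟩ := mem_grSubgroup_succ.1 hy
    have ha' := AddSubgroup.mem_sup_left (T := grSubgroup d.γ i) ha
    have hb' := AddSubgroup.mem_sup_right (S := grSubgroup d.β n) hb
    have hc : (c : ℝ) * d.γ (i + 1) ∈ ghSubgroup d.β d.γ d.len i := by
      have h1 := sup_le_ghSubgroup d.β d.γ i hN (AddSubgroup.mem_sup_left hxN)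
      have h2 := sup_le_ghSubgroup d.β d.γ i hn (add_mem ha' hb')
      convert sub_mem h1 h2 using 1
      ring
    refine add_mem ha' (add_mem ?_ hb')
    rcases d.mul_mem_sup hc with rfl | ⟨-, h⟩
    · simp
    · exact sup_le_sup_right (grSubgroup_mono _ hm) _ h

theorem Setup.eq_of_sub_mem_sup (d : Setup) {n i : ℕ} (hm : d.m i ≤ n) {k : ℕ}
    (hk : (k : ℕ∞) ≤ d.len) {A B : Vec} (hA : PermN d.q k A) (hB : PermN d.q k B)
    (h : wtA d.β k A - wtA d.β k B ∈ grSubgroup d.β n ⊔ grSubgroup d.γ i) :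
    ∀ j, n < j → j ≤ k → A j = B j := by
  induction k with
  | zero => intro j _ _; omega
  | succ k ih =>
    intro j hj hjk
    have hnk : n ≤ k := by omega
    have hkl : (k : ℕ∞) ≤ d.len := le_trans (by exact_mod_cast Nat.le_succ k) hk
    have hsup : ((A (k + 1) - B (k + 1) : ℤ) : ℝ) * d.β (k + 1) ∈
        grSubgroup d.β k ⊔ grSubgroup d.γ i := by
      have h1 := sup_le_sup_right (grSubgroup_mono d.β hnk) (grSubgroup d.γ i) h
      have h2 := AddSubgroup.mem_sup_left (T := grSubgroup d.γ i)
        (sub_mem (wtA_mem_grSubgroup d.β k A) (wtA_mem_grSubgroup d.β k B))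
      convert sub_mem h1 h2 using 1
      rw [wtA_succ, wtA_succ]; push_cast; ring
    have hmem := d.mem_grSubgroup_of_mem_sup hk hkl (hm.trans hnk)
      (mem_grSubgroup_succ.2 ⟨_, 0, zero_mem _, (add_zero _).symm⟩) hsup
    have h1 := (d.hmlen i).1
    have htop : A (k + 1) = B (k + 1) := by
      rcases eq_zero_or_dvd_of_mul_mem _ (d.hq (k + 1) (by omega) hk) hmem with h | h
      · omega
      · obtain ⟨t, hqt, -, -, hdvd⟩ := h
        have hAt := hA (k + 1) (by omega) le_rfl t hqt
        have hBt := hB (k + 1) (by omega) le_rfl t hqt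
        have := Int.eq_zero_of_abs_lt_dvd hdvd (by rw [abs_lt]; omega)
        omega
    rcases hjk.eq_or_lt with rfl | hlt
    · exact htop
    · refine ih hkl (fun l hl hlk => hA l hl (by omega)) (fun l hl hlk => hB l hl (by omega)) ?_
        j hj (by omega)
      convert h using 1
      rw [wtA_succ, wtA_succ, htop]; ring

theorem Irr.mono {T T' : Set PVec} {p p' : PVec} (h : Irr T p) (hT : T' ⊆ T) (h1 : p'.1 ≤ p.1)
    (h2 : p'.2 ≤ p.2) : Irr T' p' :=
  fun bd hbd hle => h bd (hT hbd) ⟨hle.1.trans h1, hle.2.trans h2⟩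

theorem Pset_subset_Tchain (β γ : ℕ → ℝ) (q s : ℕ → ℕ∞) (m : ℕ → ℕ) (n : ℕ) :
    Pset q ⊆ Tchain β γ q s m n := by
  induction n with
  | zero => exact subset_rfl
  | succ n ih => exact ih.trans Set.subset_union_left

theorem Setup.permN_of_irr (d : Setup) {n : ℕ} {A C : Vec}
    (h : Irr (Tchain d.β d.γ d.q d.s d.m n) (A, C)) (k : ℕ) : PermN d.q k A := by
  intro j hj _ t hqt
  by_contra! hle
  have hj2 : 2 ≤ j := by
    by_contra hlt
    obtain rfl : j = 1 := by omega
    simp [d.hq1] at hqt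
  refine h _ (Pset_subset_Tchain _ _ _ _ _ n ⟨j, hj2, t, hqt, rfl⟩) ⟨fun l => ?_, fun l => ?_⟩
  · by_cases hl : l = j
    · simpa [unitVec, hl] using hle
    · simp [unitVec, hl]
  · exact Nat.zero_le _

theorem Push.exists_red {β γ : ℕ → ℝ} {mi i : ℕ} {p : PVec} (hp : Push β γ mi i p)
    (h1 : Supp mi p.1) (h2 : Supp i p.2) :
    ∃ p' : PVec, p'.1 ≤ p.1 ∧ p'.2 ≤ p.2 ∧ Red β γ mi i p' := by
  let f : PVec → ℕ := fun p => ∑ j ∈ Finset.Icc 1 mi, p.1 j + ∑ j ∈ Finset.Icc 1 i, p.2 j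
  obtain ⟨r, ⟨hr1, hr2, hr⟩, hmin⟩ := (measure f).wf.has_min
    {p' : PVec | p'.1 ≤ p.1 ∧ p'.2 ≤ p.2 ∧ Push β γ mi i p'} ⟨p, le_rfl, le_rfl, hp⟩
  refine ⟨r, hr1, hr2, hr, fun p' hp1 hp2 hne hpush => ?_⟩
  refine hmin p' ⟨hp1.trans hr1, hp2.trans hr2, hpush⟩ ?_
  change f p' < f r
  refine lt_of_le_of_ne
    (add_le_add (Finset.sum_le_sum fun j _ => hp1 j) (Finset.sum_le_sum fun j _ => hp2 j))
    fun heq => hne ?_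
  have e1 := Finset.sum_le_sum fun j (_ : j ∈ Finset.Icc 1 mi) => hp1 j
  have e2 := Finset.sum_le_sum fun j (_ : j ∈ Finset.Icc 1 i) => hp2 j
  have eq_of_sum : ∀ {n : ℕ} {X Y Z : Vec}, Supp n Z → Y ≤ Z → X ≤ Y →
      ∑ j ∈ Finset.Icc 1 n, X j = ∑ j ∈ Finset.Icc 1 n, Y j → X = Y := by
    intro n X Y Z hZ hYZ hXY hsum
    funext j
    by_cases hj : j = 0 ∨ n < j
    · have hY : Y j = 0 := Nat.le_zero.1 (hZ j hj ▸ hYZ j)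
      exact (Nat.le_zero.1 (hY ▸ hXY j)).trans hY.symm
    · exact (Finset.sum_eq_sum_iff_of_le fun j _ => hXY j).1 hsum j
        (Finset.mem_Icc.2 (by omega))
  refine Prod.ext (eq_of_sum h1 hr1 hp1 ?_) (eq_of_sum h2 hr2 hp2 ?_) <;>
    dsimp only [f] at heq <;> omega

theorem Setup.not_last_lt (d : Setup) {k i : ℕ} (hkl : (k : ℕ∞) ≤ d.len) {A B C D : Vec}
    (hA : Supp k A) (hB : Supp k B) (hC : Supp (i + 1) C)
    (hAC : Irr (Tchain d.β d.γ d.q d.s d.m (i + 2)) (A, C))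
    (hBD : Irr (Tchain d.β d.γ d.q d.s d.m (i + 2)) (B, D))
    (hw : wt d.β d.γ k (i + 1) (A, C) = wt d.β d.γ k (i + 1) (B, D)) :
    ¬ D (i + 1) < C (i + 1) := by
  intro hlt
  simp only [wt, wtA_succ] at hw
  have hdiff : ((C (i + 1) - D (i + 1) : ℤ) : ℝ) * d.γ (i + 1) =
      (wtA d.β k B - wtA d.β k A) + (wtA d.γ i D - wtA d.γ i C) := by
    push_cast; linarith
  have hsub : wtA d.γ i D - wtA d.γ i C ∈ grSubgroup d.γ i :=
    sub_mem (wtA_mem_grSubgroup _ _ _) (wtA_mem_grSubgroup _ _ _)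
  have hgh : ((C (i + 1) - D (i + 1) : ℤ) : ℝ) * d.γ (i + 1) ∈ ghSubgroup d.β d.γ d.len i :=
    sup_le_ghSubgroup d.β d.γ i hkl <| hdiff ▸ add_mem
      (AddSubgroup.mem_sup_left (sub_mem (wtA_mem_grSubgroup _ _ _) (wtA_mem_grSubgroup _ _ _)))
      (AddSubgroup.mem_sup_right hsub)
  obtain ⟨hs, hmem⟩ := (d.mul_mem_sup hgh).resolve_left (by omega)
  set M := d.m (i + 1) with hM
  have hAB : ∀ j, M < j → A j = B j := by
    intro j hj
    by_cases hjk : j ≤ k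
    · refine (d.eq_of_sub_mem_sup (i := i) (d.m_le_succ i) hkl (d.permN_of_irr hBD k)
        (d.permN_of_irr hAC k) ?_ j hj hjk).symm
      convert sub_mem hmem (AddSubgroup.mem_sup_right (S := grSubgroup d.β M) hsub) using 1
      rw [hdiff]; ring
    · rw [hA j (by omega), hB j (by omega)]
  have htrunc : wtA d.β k A - wtA d.β k B = wtA d.β M A - wtA d.β M B := by
    have e : ∀ {n N : ℕ}, n ≤ N → (∀ j, n < j → A j = B j) →
        wtA d.β N A - wtA d.β N B = wtA d.β n A - wtA d.β n B := by
      intro n N hnN h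
      induction N, hnN using Nat.le_induction with
      | base => rfl
      | succ N hN ih => rw [← ih, wtA_succ, wtA_succ, h (N + 1) (by omega)]; ring
    rcases le_total k M with h | h
    · exact (e h fun j hj => by rw [hA j (by omega), hB j (by omega)]).symm
    · exact e h hAB
  let A' : Vec := fun j => if j ≤ M then A j else 0
  let B' : Vec := fun j => if 1 ≤ j ∧ j ≤ M then B j else 0
  let C' : Vec := fun j => if j = i + 1 then C j - D j else C j
  let D' : Vec := fun j => if 1 ≤ j ∧ j ≤ i then D j else 0
  have hA'A : A' ≤ A := fun j => by dsimp only [A']; split_ifs <;> omega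
  have hC'C : C' ≤ C := fun j => by dsimp only [C']; split_ifs <;> omega
  have hA' : Supp M A' := fun j hj => by
    have := hA j
    dsimp only [A']; split_ifs <;> omega
  have hC' : Supp (i + 1) C' := fun j hj => by
    have := hC j hj
    dsimp only [C']; split_ifs <;> omega
  have hpush : Push d.β d.γ M (i + 1) (A', C') := by
    refine ⟨by simpa [C'] using hlt, wtA d.β M B', ⟨B', fun j hj => if_neg (by omega), rfl⟩,
      wtA d.γ i D', ⟨D', fun j hj => if_neg (by omega), rfl⟩, ?_⟩
    have eA : wtA d.β M A' = wtA d.β M A := wtA_congr _ fun j _ hj => if_pos hj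
    have eB : wtA d.β M B' = wtA d.β M B := wtA_congr _ fun j h1 hj => if_pos ⟨h1, hj⟩
    have eC : wtA d.γ i C' = wtA d.γ i C := wtA_congr _ fun j _ hj => if_neg (by omega)
    have eD : wtA d.γ i D' = wtA d.γ i D := wtA_congr _ fun j h1 hj => if_pos ⟨h1, hj⟩
    have eC' : (C' (i + 1) : ℝ) = C (i + 1) - D (i + 1) := by
      simp [C', Nat.cast_sub hlt.le]
    simp only [wt, wtA_succ]
    rw [eA, eB, eC, eD, eC']
    linarith
  obtain ⟨r, hr1, hr2, hr⟩ := hpush.exists_red hA' hC'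
  have hrA := hr1.trans hA'A
  have hrC := hr2.trans hC'C
  refine hAC r (Or.inr ?_) ⟨hrA, hrC⟩
  rw [Dstep, if_neg hs]
  exact ⟨fun j hj => Nat.le_zero.1 (hA' j hj ▸ hr1 j), fun j hj => Nat.le_zero.1 (hC' j hj ▸ hr2 j),
    hAC.mono Set.subset_union_left hrA hrC, hr⟩

/-- Lemma: semigroup uniqueness. If `(A, C), (B, D) ∈ ℕ₀^k × ℕ₀^i` are
irreducible with respect to `𝒯_{i+1}` and `|(A, C)| = |(B, D)|`, then `(A, C) = (B, D)`. -/
theorem semigroup_uniqueness (d : Setup) (k i : ℕ) (hk : 1 ≤ k)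
    (hkl : (k : ℕ∞) ≤ d.len) (A C B D : Vec)
    (hA : Supp k A) (hC : Supp i C) (hB : Supp k B) (hD : Supp i D)
    (hAC : Irr (Tchain d.β d.γ d.q d.s d.m (i + 1)) (A, C))
    (hBD : Irr (Tchain d.β d.γ d.q d.s d.m (i + 1)) (B, D))
    (hw : wt d.β d.γ k i (A, C) = wt d.β d.γ k i (B, D)) :
    A = B ∧ C = D := by
  induction i generalizing C D with
  | zero =>
    have hw' : wtA d.β k A = wtA d.β k B := by simpa [wt, wtA] using hw
    refine ⟨?_, ?_⟩
    · have htop := d.eq_of_sub_mem_sup (i := 0) d.hm0.le hkl (d.permN_of_irr hAC k)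
        (d.permN_of_irr hBD k) (by rw [hw', sub_self]; exact zero_mem _)
      have hone : A 1 = B 1 := by
        have hsum : ∑ j ∈ Finset.Icc 1 k, ((A j : ℝ) - B j) * d.β j = 0 := by
          simpa [wtA, sub_mul, sub_eq_zero] using hw'
        rw [Finset.sum_eq_single_of_mem 1 (Finset.mem_Icc.2 ⟨le_rfl, hk⟩)] at hsum
        · have := (mul_eq_zero.1 hsum).resolve_right (d.hβ 1 le_rfl d.one_le_len).ne'
          exact_mod_cast sub_eq_zero.1 this
        · intro j hj hj1
          have := Finset.mem_Icc.1 hj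
          simp [htop j (by omega) this.2]
      funext j
      by_cases hj : j = 0 ∨ k < j
      · rw [hA j hj, hB j hj]
      · rcases eq_or_ne j 1 with rfl | hj1
        · exact hone
        · exact htop j (by omega) (by omega)
    · funext j
      rw [hC j (by omega), hD j (by omega)]
  | succ i ih =>
    have hlast : C (i + 1) = D (i + 1) :=
      le_antisymm (not_lt.1 (d.not_last_lt hkl hA hB hC hAC hBD hw))
        (not_lt.1 (d.not_last_lt hkl hB hA hD hBD hAC hw.symm))
    have trunc : ∀ E : Vec, wtA d.γ i (fun j => if j ≤ i then E j else 0) = wtA d.γ i E :=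
      fun E => wtA_congr _ fun j _ hj => if_pos hj
    have supp : ∀ E : Vec, Supp (i + 1) E → Supp i (fun j => if j ≤ i then E j else 0) := by
      intro E hE j hj
      have := hE j
      dsimp only
      split_ifs <;> omega
    have le : ∀ E : Vec, (fun j => if j ≤ i then E j else 0) ≤ E := by
      intro E j
      dsimp only
      split_ifs <;> omega
    obtain ⟨hAB, hCD⟩ := ih _ _ (supp C hC) (supp D hD)
      (hAC.mono Set.subset_union_left le_rfl (le C))
      (hBD.mono Set.subset_union_left le_rfl (le D)) (by
        simp only [wt, wtA_succ, hlast] at hw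
        simp only [wt, trunc]
        linarith)
    refine ⟨hAB, funext fun j => ?_⟩
    rcases lt_trichotomy j (i + 1) with hj | rfl | hj
    · simpa [Nat.lt_succ_iff.1 hj] using congrFun hCD j
    · exact hlast
    · rw [hC j (Or.inr hj), hD j (Or.inr hj)]

end Jump
end

section
/- Suppose k ∈ ℕ and i ∈ ℕ₀. If (A,C) ∈ ℤ^k × ℤ^i and (B,D) ∈ ℤ^k × ℤ^i are permissible coefficient vectors such that |(A,C)| = |(B,D)|, then (A,C) = (B,D). -/
namespace Jump

theorem wtZ_succ (β : ℕ → ℝ) (n : ℕ) (A : ℕ → ℤ) :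
    wtZ β (n + 1) A = wtZ β n A + (A (n + 1) : ℝ) * β (n + 1) := by
  simp [wtZ, Finset.sum_Icc_succ_top]

theorem wtZ_sub (β : ℕ → ℝ) (n : ℕ) (A B : ℕ → ℤ) :
    wtZ β n (fun j => A j - B j) = wtZ β n A - wtZ β n B := by
  simp [wtZ, sub_mul, Finset.sum_sub_distrib]

theorem wtZ_neg (β : ℕ → ℝ) (n : ℕ) (A : ℕ → ℤ) :
    wtZ β n (fun j => -A j) = -wtZ β n A := by
  simp [wtZ]

theorem wtZ_congr (β : ℕ → ℝ) {n : ℕ} {A B : ℕ → ℤ}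
    (h : ∀ j, 1 ≤ j → j ≤ n → A j = B j) : wtZ β n A = wtZ β n B := by
  refine Finset.sum_congr rfl fun j hj => ?_
  rw [Finset.mem_Icc] at hj
  rw [h j hj.1 hj.2]

theorem wtZ_mem_Gr (β : ℕ → ℝ) (n : ℕ) (A : ℕ → ℤ) : wtZ β n A ∈ Gr β n := by
  refine ⟨fun j => if 1 ≤ j ∧ j ≤ n then A j else 0, fun j hj => if_neg (by omega), ?_⟩
  exact wtZ_congr β fun j h1 h2 => (if_pos ⟨h1, h2⟩).symm

theorem neg_mem_Gr {β : ℕ → ℝ} {n : ℕ} {x : ℝ} (hx : x ∈ Gr β n) : -x ∈ Gr β n := by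
  obtain ⟨A, -, rfl⟩ := hx
  rw [← wtZ_neg]
  exact wtZ_mem_Gr β n _

theorem neg_mem_GH {β γ : ℕ → ℝ} {len : ℕ∞} {i : ℕ} {x : ℝ} (hx : x ∈ GH β γ len i) :
    -x ∈ GH β γ len i := by
  obtain ⟨k, hk, a, ha, b, hb, rfl⟩ := hx
  exact ⟨k, hk, -a, neg_mem_Gr ha, -b, neg_mem_Gr hb, by ring⟩

/-- Two integers that are reduced modulo the order `q` of `x` relative to a symmetric set `S`
coincide as soon as their difference multiplies `x` into `S`. -/
theorem eq_of_sub_mul_mem {S : Set ℝ} (hS : ∀ y ∈ S, -y ∈ S) {q : ℕ∞} {x : ℝ}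
    (hq : q = sInf {z : ℕ∞ | ∃ t : ℕ, z = (t : ℕ∞) ∧ 0 < t ∧ (t : ℝ) * x ∈ S}) {a b : ℤ}
    (ha : ∀ t : ℕ, q = (t : ℕ∞) → 0 ≤ a ∧ a < (t : ℤ))
    (hb : ∀ t : ℕ, q = (t : ℕ∞) → 0 ≤ b ∧ b < (t : ℤ))
    (h : ((a : ℝ) - b) * x ∈ S) : a = b := by
  by_contra hab
  have hmem : (((a - b).natAbs : ℕ) : ℝ) * x ∈ S := by
    rw [Nat.cast_natAbs]
    rcases abs_choice (a - b) with h' | h' <;> rw [h']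
    · simpa using h
    · have := hS _ h
      rw [← neg_mul] at this
      simpa using this
  have hle : q ≤ ((a - b).natAbs : ℕ∞) := by
    rw [hq]
    exact sInf_le ⟨_, rfl, by omega, hmem⟩
  obtain ⟨t, rfl⟩ := ENat.ne_top_iff_exists.mp (ne_top_of_le_ne_top (ENat.natCast_ne_top _) hle)
  have hle' : t ≤ (a - b).natAbs := by exact_mod_cast hle
  have := ha t rfl
  have := hb t rfl
  omega

theorem Setup.eq_of_wtZ_eq (d : Setup) {k : ℕ} (hk : 1 ≤ k) {A B : ℕ → ℤ}
    (hkl : (k : ℕ∞) ≤ d.len) (hA : PermZ d.q k A) (hB : PermZ d.q k B)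
    (hw : wtZ d.β k A = wtZ d.β k B) : ∀ j, 1 ≤ j → j ≤ k → A j = B j := by
  induction k, hk using Nat.le_induction with
  | base =>
    intro j h1 h2
    obtain rfl : j = 1 := le_antisymm h2 h1
    have hpos := d.hβ 1 le_rfl hkl
    simpa [wtZ, hpos.ne'] using hw
  | succ n hn ih =>
    have htop : A (n + 1) = B (n + 1) := by
      refine eq_of_sub_mul_mem (fun y hy => neg_mem_Gr hy) (d.hq (n + 1) (by omega) hkl)
        (hA (n + 1) (by omega) le_rfl) (hB (n + 1) (by omega) le_rfl) ?_
      have h : ((A (n + 1) : ℝ) - B (n + 1)) * d.β (n + 1) =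
          wtZ d.β n (fun j => B j - A j) := by
        rw [wtZ_succ, wtZ_succ] at hw
        rw [wtZ_sub]
        linarith
      rw [h]
      exact wtZ_mem_Gr d.β n _
    have hw' : wtZ d.β n A = wtZ d.β n B := by
      rw [wtZ_succ, wtZ_succ, htop] at hw
      linarith
    have hlen : (n : ℕ∞) ≤ d.len := le_trans (by exact_mod_cast n.le_succ) hkl
    have hlow := ih hlen (fun j h1 h2 => hA j h1 (by omega))
      (fun j h1 h2 => hB j h1 (by omega)) hw'
    intro j h1 h2
    rcases Nat.le_succ_iff.mp h2 with h | rfl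
    · exact hlow j h1 h
    · exact htop

theorem Setup.eq_of_wtZ_add_wtZ_eq (d : Setup) {k i : ℕ} (hkl : (k : ℕ∞) ≤ d.len)
    {A B C D : ℕ → ℤ} (hC : PermZ d.s i C) (hD : PermZ d.s i D)
    (hw : wtZ d.β k A + wtZ d.γ i C = wtZ d.β k B + wtZ d.γ i D) :
    ∀ j, 1 ≤ j → j ≤ i → C j = D j := by
  induction i with
  | zero => intro j h1 h2; omega
  | succ n ih =>
    have htop : C (n + 1) = D (n + 1) := by
      refine eq_of_sub_mul_mem (fun y hy => neg_mem_GH hy) (d.hs (n + 1) (by omega))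
        (hC (n + 1) (by omega) le_rfl) (hD (n + 1) (by omega) le_rfl) ?_
      refine ⟨k, hkl, _, wtZ_mem_Gr d.β k (fun j => B j - A j), _,
        wtZ_mem_Gr d.γ n (fun j => D j - C j), ?_⟩
      rw [wtZ_succ, wtZ_succ] at hw
      rw [wtZ_sub, wtZ_sub]
      linarith
    have hlow := ih (fun j h1 h2 => hC j h1 (by omega)) (fun j h1 h2 => hD j h1 (by omega)) (by
      rw [wtZ_succ, wtZ_succ, htop] at hw
      linarith)
    intro j h1 h2
    rcases Nat.le_succ_iff.mp h2 with h | rfl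
    · exact hlow j h1 h
    · exact htop

theorem SuppZ.ext {n : ℕ} {A B : ℕ → ℤ} (hA : SuppZ n A) (hB : SuppZ n B)
    (h : ∀ j, 1 ≤ j → j ≤ n → A j = B j) : A = B := by
  funext j
  by_cases hj : j = 0 ∨ n < j
  · rw [hA j hj, hB j hj]
  · exact h j (by omega) (by omega)

/-- Lemma: group uniqueness. If `(A, C), (B, D) ∈ ℤ^k × ℤ^i` are
permissible coefficient vectors with `|(A, C)| = |(B, D)|`, then `(A, C) = (B, D)`. -/
theorem group_uniqueness (d : Setup) (k i : ℕ) (hk : 1 ≤ k) (hkl : (k : ℕ∞) ≤ d.len)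
    (A C B D : ℕ → ℤ)
    (hA : SuppZ k A) (hC : SuppZ i C) (hB : SuppZ k B) (hD : SuppZ i D)
    (hAp : PermZ d.q k A) (hCp : PermZ d.s i C)
    (hBp : PermZ d.q k B) (hDp : PermZ d.s i D)
    (hw : wtZ d.β k A + wtZ d.γ i C = wtZ d.β k B + wtZ d.γ i D) :
    A = B ∧ C = D := by
  obtain rfl : C = D := hC.ext hD (d.eq_of_wtZ_add_wtZ_eq hkl hCp hDp hw)
  exact ⟨hA.ext hB (d.eq_of_wtZ_eq hk hkl hAp hBp (add_right_cancel hw)), rfl⟩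

end Jump
end
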